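/- Let f ∈ 𝒮(ℝⁿ) be a Schwartz function with f(0) = 0. Then there exist Schwartz functions f₁, …, f_n ∈ 𝒮(ℝⁿ) such that f(ξ) = ∑_{j=1}^{n} ξ_j f_j(ξ) for all ξ ∈ ℝⁿ. -/

import Mathlib

open scoped ContDiff Convolution
open MeasureTheory

/-- Smoothness of a parametric integral over the unit interval. -/
lemma contDiff_integral_ray {E : Type*} [NormedAddCommGroup E] [NormedSpace ℝ E]
    (φ : E → ℂ) (hφ : ContDiff ℝ ∞ φ) :
    ContDiff ℝ ∞ (fun p : E => ∫ t in (0 : ℝ)..1, φ (t • p)) := by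
  let b : ContDiffBump (0 : ℝ) := ⟨2, 3, by norm_num, by norm_num⟩
  let g : E → ℝ → ℂ := fun p x => b x • φ ((-x) • p)
  let k : ℝ → ℝ := (Set.Ioc (0 : ℝ) 1).indicator (fun _ => 1)
  have hk : LocallyIntegrable k volume := by
    apply Integrable.locallyIntegrable
    rw [integrable_indicator_iff measurableSet_Ioc]
    simp
  have hg : ContDiff ℝ ∞ (Function.uncurry g) := by
    have h1 : ContDiff ℝ ∞ (fun q : E × ℝ => b q.2) := b.contDiff.comp contDiff_snd
    have h2 : ContDiff ℝ ∞ (fun q : E × ℝ => φ ((-q.2) • q.1)) :=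
      hφ.comp (contDiff_snd.neg.smul contDiff_fst)
    exact h1.smul h2
  have key := contDiffOn_convolution_right_with_param (𝕜 := ℝ) (n := ⊤) (f := k) (g := g)
    (μ := volume)
    (ContinuousLinearMap.lsmul ℝ ℝ) (s := Set.univ) (k := Metric.closedBall 0 3) isOpen_univ
    (isCompact_closedBall _ _)
    (by
      intro p x _ hx
      have : b x = 0 := b.zero_of_le_dist (by
        have h3 : (3 : ℝ) < dist x 0 := by simpa [Metric.mem_closedBall] using hx
        exact h3.le)
      simp [g, this]) hk hg.contDiffOn
  rw [Set.univ_prod_univ, contDiffOn_univ] at key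
  have h3 : ContDiff ℝ ∞ (fun p : E => (p, (0 : ℝ))) := contDiff_id.prodMk contDiff_const
  have key2 := key.comp h3
  convert key2 using 1
  ext p
  rw [intervalIntegral.integral_of_le zero_le_one, ← integral_indicator measurableSet_Ioc]
  simp only [Function.comp, convolution]
  congr 1
  ext t
  by_cases ht : t ∈ Set.Ioc (0 : ℝ) 1
  · have : b (-t) = 1 := b.one_of_mem_closedBall (by
      have : |t| ≤ 2 := by rw [abs_of_pos ht.1]; linarith [ht.2]
      simpa using this)
    simp [k, g, ht, this]
  · simp [k, ht]

/-- The Hadamard lemma. -/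
lemma hadamard_smooth {n : ℕ} (h : EuclideanSpace ℝ (Fin n) → ℂ) (hh : ContDiff ℝ ∞ h)
    (h0 : h 0 = 0) :
    ∃ G : Fin n → EuclideanSpace ℝ (Fin n) → ℂ, (∀ j, ContDiff ℝ ∞ (G j)) ∧
      ∀ ξ : EuclideanSpace ℝ (Fin n), h ξ = ∑ j : Fin n, (ξ j : ℂ) * G j ξ := by
  have hd : ContDiff ℝ ∞ (fderiv ℝ h) := hh.fderiv_right (by simp)
  have hdj : ∀ j : Fin n, ContDiff ℝ ∞ (fun x => fderiv ℝ h x (EuclideanSpace.single j 1)) :=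
    fun j => hd.clm_apply contDiff_const
  refine ⟨fun j p => ∫ t in (0 : ℝ)..1, fderiv ℝ h (t • p) (EuclideanSpace.single j 1),
    fun j => contDiff_integral_ray _ (hdj j), fun ξ => ?_⟩
  have hcont : ∀ j : Fin n, Continuous
      (fun t : ℝ => fderiv ℝ h (t • ξ) (EuclideanSpace.single j 1)) := fun j =>
    (hdj j).continuous.comp (by fun_prop)
  have hder : ∀ t : ℝ, HasDerivAt (fun t : ℝ => h (t • ξ)) (fderiv ℝ h (t • ξ) ξ) t := by
    intro t
    have h1 : HasDerivAt (fun t : ℝ => t • ξ) ξ t := by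
      simpa using (hasDerivAt_id t).smul_const ξ
    exact ((hh.differentiable (by simp)) (t • ξ)).hasFDerivAt.comp_hasDerivAt t h1
  have hcont' : Continuous (fun t : ℝ => fderiv ℝ h (t • ξ) ξ) :=
    (hd.continuous.comp (by fun_prop)).clm_apply continuous_const
  have h1 := intervalIntegral.integral_eq_sub_of_hasDerivAt (a := 0) (b := 1)
    (fun t _ => hder t) (hcont'.intervalIntegrable _ _)
  simp only [one_smul, zero_smul, h0, sub_zero] at h1
  rw [← h1]
  simp_rw [← intervalIntegral.integral_const_mul]
  rw [← intervalIntegral.integral_finsetSum]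
  swap
  · exact fun j _ => Continuous.intervalIntegrable (continuous_const.mul (hcont j)) _ _
  have hL : ∀ L : EuclideanSpace ℝ (Fin n) →L[ℝ] ℂ,
      L ξ = ∑ j, (ξ j : ℂ) * L (EuclideanSpace.single j 1) := by
    intro L
    have hξ : ξ = ∑ j, ξ j • EuclideanSpace.single j (1 : ℝ) := by
      ext i
      simp [Finset.sum_apply, Pi.single_apply]
    calc L ξ = L (∑ j, ξ j • EuclideanSpace.single j (1 : ℝ)) := congrArg L hξ
      _ = _ := by
        rw [map_sum]
        refine Finset.sum_congr rfl fun j _ => ?_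
        rw [map_smul, Complex.real_smul]
  congr 1
  ext t
  exact hL _

/-- Temperate growth of the reciprocal. -/
lemma temperate_inv {E : Type*} [NormedAddCommGroup E] [NormedSpace ℝ E]
    (u : E → ℝ) (hu : u.HasTemperateGrowth) (h1 : ∀ x, 1 < u x) :
    (fun x => (u x)⁻¹).HasTemperateGrowth := by
  have ho : IsOpen (Set.Ioi (1 : ℝ)) := isOpen_Ioi
  have hc : ContDiffOn ℝ ∞ (fun s : ℝ => s⁻¹) (Set.Ioi (1 : ℝ)) :=
    contDiffOn_id.inv fun x hx => (zero_lt_one.trans hx).ne'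
  refine Function.HasTemperateGrowth.comp' (g := fun s : ℝ => s⁻¹) (t := Set.Ioi 1) ?_
    ho.uniqueDiffOn hc ?_ hu
  · rintro _ ⟨x, rfl⟩
    exact h1 x
  · intro N
    refine ⟨0, N.factorial, by positivity, fun n hn x hx => ?_⟩
    have hx1 : (1 : ℝ) < x := hx
    have hcx : ContDiffAt ℝ n (fun s : ℝ => s⁻¹) x :=
      contDiffAt_id.inv (zero_lt_one.trans hx1).ne'
    rw [norm_iteratedFDerivWithin_eq_norm_iteratedDerivWithin,
      iteratedDerivWithin_eq_iteratedDeriv ho.uniqueDiffOn hcx hx, iteratedDeriv_eq_iterate,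
      iter_deriv_inv]
    have h2 : |x ^ (-1 - n : ℤ)| ≤ 1 := by
      rw [abs_of_pos (by positivity)]
      exact zpow_le_one_of_nonpos₀ hx1.le (by omega)
    have h3 : (n.factorial : ℝ) ≤ N.factorial := by exact_mod_cast Nat.factorial_le hn
    simp only [norm_mul, norm_pow, norm_neg, norm_one, one_pow, one_mul, pow_zero, mul_one,
      Real.norm_eq_abs, Nat.abs_cast]
    calc (n.factorial : ℝ) * |x ^ (-1 - n : ℤ)| ≤ n.factorial * 1 := by gcongr
      _ ≤ _ := by simpa using h3

/-- Hadamard-type division lemma for Schwartz functions: If `f` is a Schwartz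
function on `ℝⁿ` with `f(0) = 0`, then there are Schwartz functions `f₁, …, f_n` with
`f(ξ) = ∑_j ξ_j f_j(ξ)` for all `ξ`. -/
theorem schwartz_division_lemma {n : ℕ}
    (f : SchwartzMap (EuclideanSpace ℝ (Fin n)) ℂ) (hf : f 0 = 0) :
    ∃ g : Fin n → SchwartzMap (EuclideanSpace ℝ (Fin n)) ℂ,
      ∀ ξ : EuclideanSpace ℝ (Fin n), f ξ = ∑ j : Fin n, (ξ j : ℂ) * g j ξ := by
  let b : ContDiffBump (0 : EuclideanSpace ℝ (Fin n)) := ⟨2, 3, by norm_num, by norm_num⟩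
  have hb : ContDiff ℝ ∞ (b : EuclideanSpace ℝ (Fin n) → ℝ) := b.contDiff
  have hbt : (b : EuclideanSpace ℝ (Fin n) → ℝ).HasTemperateGrowth :=
    b.hasCompactSupport.hasTemperateGrowth hb
  let u : EuclideanSpace ℝ (Fin n) → ℝ := fun ξ => ‖ξ‖ ^ 2 + 2 * b ξ
  have hu : u.HasTemperateGrowth :=
    (Function.hasTemperateGrowth_norm_sq _).add
      ((Function.HasTemperateGrowth.const (2 : ℝ)).mul hbt)
  have hu1 : ∀ ξ, 1 < u ξ := by
    intro ξ
    by_cases hξ : ‖ξ‖ ≤ 2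
    · have : b ξ = 1 := b.one_of_mem_closedBall (by simpa using hξ)
      simp only [u, this]
      nlinarith [sq_nonneg ‖ξ‖]
    · have := b.nonneg (x := ξ)
      simp only [u]
      nlinarith
  let h : SchwartzMap (EuclideanSpace ℝ (Fin n)) ℂ :=
    SchwartzMap.smulLeftCLM ℂ (fun ξ => (u ξ)⁻¹) f
  have hh : ∀ ξ, h ξ = ((u ξ)⁻¹ : ℝ) • f ξ :=
    fun ξ => SchwartzMap.smulLeftCLM_apply_apply (temperate_inv u hu hu1) f ξ
  obtain ⟨G, hG, hGe⟩ := hadamard_smooth h (h.smooth ⊤) (by rw [hh, hf, smul_zero])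
  have hc : ∀ j, HasCompactSupport (fun ξ => (2 * b ξ) • G j ξ) := fun j =>
    (b.hasCompactSupport.mul_left (f := fun _ => (2 : ℝ))).smul_right
  have hs : ∀ j, ContDiff ℝ ∞ (fun ξ => (2 * b ξ) • G j ξ) := fun j =>
    (contDiff_const.mul hb).smul (hG j)
  have hpt : ∀ j : Fin n,
      (fun ξ : EuclideanSpace ℝ (Fin n) => ξ j).HasTemperateGrowth := fun j =>
    (EuclideanSpace.proj (𝕜 := ℝ) j : EuclideanSpace ℝ (Fin n) →L[ℝ] ℝ).hasTemperateGrowth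
  refine ⟨fun j => SchwartzMap.smulLeftCLM ℂ (fun ξ : EuclideanSpace ℝ (Fin n) => ξ j) h +
    (hc j).toSchwartzMap (hs j), fun ξ => ?_⟩
  have hval : ∀ j : Fin n, (SchwartzMap.smulLeftCLM ℂ (fun ξ : EuclideanSpace ℝ (Fin n) => ξ j) h +
    (hc j).toSchwartzMap (hs j)) ξ = (ξ j : ℂ) * h ξ + (2 * b ξ : ℝ) * G j ξ := by
    intro j
    have e1 := SchwartzMap.smulLeftCLM_apply_apply (hpt j) h ξ
    have e2 : (hc j).toSchwartzMap (hs j) ξ = (2 * b ξ) • G j ξ := rfl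
    rw [add_apply, e1, e2, Complex.real_smul, Complex.real_smul]
  simp_rw [hval, mul_add, Finset.sum_add_distrib]
  have s1 : ∑ j, (ξ j : ℂ) * ((ξ j : ℂ) * h ξ) = ((‖ξ‖ ^ 2 : ℝ) : ℂ) * h ξ := by
    rw [EuclideanSpace.real_norm_sq_eq, Complex.ofReal_sum, Finset.sum_mul]
    refine Finset.sum_congr rfl fun j _ => ?_
    push_cast
    ring
  have s2 : ∑ j, (ξ j : ℂ) * ((2 * b ξ : ℝ) * G j ξ) = ((2 * b ξ : ℝ) : ℂ) * h ξ := by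
    rw [hGe ξ, Finset.mul_sum]
    refine Finset.sum_congr rfl fun j _ => ?_
    ring
  rw [s1, s2, ← add_mul, ← Complex.ofReal_add]
  change f ξ = (u ξ : ℂ) * h ξ
  have hne : (u ξ : ℂ) ≠ 0 := by exact_mod_cast (zero_lt_one.trans (hu1 ξ)).ne'
  rw [hh, Complex.real_smul, Complex.ofReal_inv, mul_inv_cancel_left₀ hne]
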